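/- arXiv:1503.03462 — 3 statements merged into one kernel-verified Lean document; each statement's English description precedes it below -/
import Mathlib

section
/- Let a < b < c < d < e < f be real numbers and let P(t) = (t, t²). Suppose the three segments s₁ = [P(a), P(d)], s₂ = [P(b), P(e)], s₃ = [P(c), P(f)] intersect concavely, i.e., the x-coordinate of the intersection point s₃ ∩ s₂ is strictly smaller than the x-coordinate of s₂ ∩ s₁. Set α₁ = b − a, α₂ = c − b, γ = d − c, β₁ = e − d, β₂ = f − e. Then α₁/β₁ > α₂/γ and β₂/α₂ > β₁/γ. -/
/-- The point of the parabola `y = x²` with x-coordinate `t`. -/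
noncomputable def Ppt (t : ℝ) : ℝ × ℝ := (t, t ^ 2)

/-- The closed straight-line segment between the points of the parabola with
x-coordinates `a` and `b`. -/
noncomputable def Seg (a b : ℝ) : Set (ℝ × ℝ) := segment ℝ (Ppt a) (Ppt b)

theorem mem_Seg_aux (p q x y : ℝ) (hpq : p < q) (h1 : p ≤ x) (h2 : x ≤ q)
    (hy : y = (p + q) * x - p * q) : (x, y) ∈ Seg p q := by
  have h : 0 < q - p := sub_pos.2 hpq
  have h' := h.ne'
  refine ⟨(q - x) / (q - p), (x - p) / (q - p), div_nonneg (by linarith) h.le,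
    div_nonneg (by linarith) h.le, ?_, ?_⟩
  · field_simp
    ring
  · subst hy
    ext
    · simp only [Ppt, Prod.smul_mk, Prod.mk_add_mk, smul_eq_mul]
      field_simp
      ring
    · simp only [Ppt, Prod.smul_mk, Prod.mk_add_mk, smul_eq_mul]
      field_simp
      ring

theorem inter_aux (a b d e : ℝ) (hab : a < b) (hbd : b < d) (hde : d < e) :
    ∃ x y : ℝ, b < x ∧ x < d ∧ x * ((b - a) + (e - d)) = b * e - a * d ∧
      (x, y) ∈ Seg a d ∧ (x, y) ∈ Seg b e := by
  have h : 0 < (b - a) + (e - d) := by linarith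
  obtain ⟨x, hx⟩ : ∃ x : ℝ, x * ((b - a) + (e - d)) = b * e - a * d :=
    ⟨(b * e - a * d) / ((b - a) + (e - d)), div_mul_cancel₀ _ h.ne'⟩
  have h1 : b < x := by
    have : 0 < (x - b) * ((b - a) + (e - d)) := by
      have := mul_pos (sub_pos.2 hab) (sub_pos.2 hbd)
      linarith
    linarith [pos_of_mul_pos_left this h.le]
  have h2 : x < d := by
    have : 0 < (d - x) * ((b - a) + (e - d)) := by
      have := mul_pos (sub_pos.2 hde) (sub_pos.2 hbd)
      linarith
    linarith [pos_of_mul_pos_left this h.le]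
  exact ⟨x, (a + d) * x - a * d, h1, h2, hx,
    mem_Seg_aux _ _ _ _ (by linarith) (by linarith) (by linarith) rfl,
    mem_Seg_aux _ _ _ _ (by linarith) (by linarith) (by linarith) (by linarith)⟩

/-- First claim of Lemma `lem_ratios`: if the chords `[P(a),P(d)]`, `[P(b),P(e)]`,
`[P(c),P(f)]` of the parabola (with `a < b < c < d < e < f`) intersect concavely,
i.e. the intersection point of the third and second chords lies strictly to the left
of the intersection point of the second and first chords, then with
`α₁ = b − a`, `α₂ = c − b`, `γ = d − c`, `β₁ = e − d`, `β₂ = f − e` we have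
`α₁/β₁ > α₂/γ` and `β₂/α₂ > β₁/γ`. -/
theorem lem_ratios_first (a b c d e f : ℝ)
    (hab : a < b) (hbc : b < c) (hcd : c < d) (hde : d < e) (hef : e < f)
    (hconc : ∀ z w : ℝ × ℝ, z ∈ Seg c f ∩ Seg b e → w ∈ Seg b e ∩ Seg a d →
      z.1 < w.1) :
    (b - a) / (e - d) > (c - b) / (d - c) ∧ (f - e) / (c - b) > (e - d) / (d - c) := by
  obtain ⟨x, y, hx1, hx2, hx, hxa, hxb⟩ := inter_aux a b d e hab (by linarith) hde
  obtain ⟨u, v, hu1, hu2, hu, hua, hub⟩ := inter_aux b c e f hbc (by linarith) hef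
  have hlt : u < x := hconc (u, v) (x, y) ⟨hub, hua⟩ ⟨hxb, hxa⟩
  have k1 := mul_pos (show 0 < x - c by linarith) (show 0 < (b - a) + (e - d) by linarith)
  have k2 := mul_pos (show 0 < d - u by linarith) (show 0 < (c - b) + (f - e) by linarith)
  constructor
  · rw [gt_iff_lt, div_lt_div_iff₀ (by linarith) (by linarith)]
    linarith
  · rw [gt_iff_lt, div_lt_div_iff₀ (by linarith) (by linarith)]
    linarith
end

section
/- Let s₁, …, sₘ (m ≥ 3) be segments with all endpoints on the parabola y = x², whose endpoints appear in the left-to-right order L_{s₁}, …, L_{sₘ}, R_{s₁}, …, R_{sₘ}, which form a wide set and which intersect concavely. Let α_k = x(L_{s_{k+1}}) − x(L_{s_k}) for 1 ≤ k ≤ m − 1. Then α_k > α_{k+1} + α_{k+2} + ⋯ + α_{m−1} for each 1 ≤ k ≤ m − 2. -/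
theorem mem_Seg_aux_s4 {a b x : ℝ} (hab : a < b) (h1 : a ≤ x) (h2 : x ≤ b) :
    ((x, (a + b) * x - a * b) : ℝ × ℝ) ∈ Seg a b := by
  have h : b - a ≠ 0 := by linarith
  have h' : 0 < b - a := by linarith
  refine ⟨(b - x) / (b - a), (x - a) / (b - a), div_nonneg (by linarith) h'.le,
    div_nonneg (by linarith) h'.le, by field_simp; ring, ?_⟩
  simp only [Ppt, Prod.smul_mk, Prod.mk_add_mk, smul_eq_mul, Prod.mk.injEq]
  constructor <;> field_simp <;> ring

noncomputable def XX (L R : ℕ → ℝ) (k : ℕ) : ℝ :=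
  (L (k + 1) * R (k + 1) - L k * R k) / ((L (k + 1) + R (k + 1)) - (L k + R k))

theorem cross_aux {a b p q x : ℝ} (hab : a < b) (hbp : b < p) (hpq : p < q)
    (hx : x = (b * q - a * p) / ((b + q) - (a + p))) :
    b < x ∧ x < p ∧ (a + p) * x - a * p = (b + q) * x - b * q := by
  have hd : 0 < (b + q) - (a + p) := by linarith
  refine ⟨?_, ?_, ?_⟩
  · rw [hx, lt_div_iff₀ hd]
    nlinarith [mul_pos (sub_pos.2 hab) (sub_pos.2 hbp)]
  · rw [hx, div_lt_iff₀ hd]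
    nlinarith [mul_pos (sub_pos.2 hpq) (sub_pos.2 hbp)]
  · have : x * ((b + q) - (a + p)) = b * q - a * p := by rw [hx]; field_simp
    linarith

theorem sum_tel_aux (L : ℕ → ℝ) (a d : ℕ) :
    ∑ i ∈ Finset.Icc a (a + d), (L (i + 1) - L i) = L (a + d + 1) - L a := by
  induction d with
  | zero => simp
  | succ d ih =>
    rw [← add_assoc, Finset.sum_Icc_succ_top (by omega), ih]
    ring

/-- Lemma `lemma_wide_fan`: let `s₁, …, sₘ` (`m ≥ 3`) be segments with all endpoints
on the parabola `y = x²` (segment `sᵢ` joining the parabola points with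
x-coordinates `L i < R i`), whose endpoints appear in the left-to-right order
`L 1 < L 2 < ⋯ < L m < R 1 < ⋯ < R m`, which form a wide set and intersect
concavely.  With `α k = L (k+1) − L k`, we have
`α k > α (k+1) + ⋯ + α (m−1)` for each `1 ≤ k ≤ m − 2`. -/
theorem lemma_wide_fan (m : ℕ) (hm : 3 ≤ m) (L R : ℕ → ℝ)
    (hLL : ∀ i, 1 ≤ i → i < m → L i < L (i + 1))
    (hLR : L m < R 1)
    (hRR : ∀ i, 1 ≤ i → i < m → R i < R (i + 1))
    (hwide : ∀ k, 2 ≤ k → k ≤ m → R k - L 1 > 2 * (R (k - 1) - L 1))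
    (hconc : ∀ k, 1 ≤ k → k + 2 ≤ m → ∀ z w : ℝ × ℝ,
      z ∈ Seg (L (k + 2)) (R (k + 2)) ∩ Seg (L (k + 1)) (R (k + 1)) →
      w ∈ Seg (L (k + 1)) (R (k + 1)) ∩ Seg (L k) (R k) → z.1 < w.1) :
    ∀ k, 1 ≤ k → k ≤ m - 2 →
      L (k + 1) - L k > ∑ i ∈ Finset.Icc (k + 1) (m - 1), (L (i + 1) - L i) := by
  have hL : ∀ d i, 1 ≤ i → i + d ≤ m → L i ≤ L (i + d) := by
    intro d
    induction d with
    | zero => intro i _ _; simp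
    | succ d ih =>
      intro i h1 h2
      have := ih i h1 (by omega)
      have := hLL (i + d) (by omega) (by omega)
      rw [← add_assoc]; linarith
  have hR : ∀ d, 1 + d ≤ m → R 1 ≤ R (1 + d) := by
    intro d
    induction d with
    | zero => intro _; simp
    | succ d ih =>
      intro h2
      have := ih (by omega)
      have := hRR (1 + d) (by omega) (by omega)
      rw [← add_assoc]; linarith
  have hLm : ∀ i j, 1 ≤ i → i ≤ j → j ≤ m → L i ≤ L j := by
    intro i j h1 h2 h3
    have := hL (j - i) i h1 (by omega)
    rwa [Nat.add_sub_cancel' h2] at this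
  have hR1 : ∀ j, 1 ≤ j → j ≤ m → R 1 ≤ R j := by
    intro j h2 h3
    have := hR (j - 1) (by omega)
    rwa [Nat.add_sub_cancel' h2] at this
  have key : ∀ k, 1 ≤ k → k < m → L k < L (k + 1) ∧ L (k + 1) < R k ∧ R k < R (k + 1) := by
    intro k h1 h2
    refine ⟨hLL k h1 h2, ?_, hRR k h1 h2⟩
    have := hLm (k + 1) m (by omega) (by omega) le_rfl
    have := hR1 k h1 (by omega)
    linarith
  have hc : ∀ k, 1 ≤ k → k < m → L (k + 1) < XX L R k ∧ ∃ z : ℝ × ℝ, z.1 = XX L R k ∧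
      z ∈ Seg (L (k + 1)) (R (k + 1)) ∩ Seg (L k) (R k) := by
    intro k h1 h2
    obtain ⟨e1, e2, e3⟩ := key k h1 h2
    obtain ⟨f1, f2, f3⟩ := cross_aux e1 e2 e3 (x := XX L R k) rfl
    refine ⟨f1, (XX L R k, (L k + R k) * XX L R k - L k * R k), rfl, ?_, ?_⟩
    · rw [f3]
      exact mem_Seg_aux_s4 (by linarith) (by linarith) (by linarith)
    · exact mem_Seg_aux_s4 (by linarith) (by linarith) (by linarith)
  have hX : ∀ d k, 1 ≤ k → k + d + 1 = m → L m < XX L R k := by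
    intro d
    induction d with
    | zero =>
      intro k h1 h2
      have := (hc k h1 (by omega)).1
      rw [← h2]; simpa using this
    | succ d ih =>
      intro k h1 h2
      have h3 := ih (k + 1) (by omega) (by omega)
      obtain ⟨_, z, hz, hz'⟩ := hc (k + 1) (by omega) (by omega)
      obtain ⟨_, w, hw, hw'⟩ := hc k (by omega) (by omega)
      have := hconc k h1 (by omega) z w hz' hw'
      linarith
  intro k h1 h2
  have hs := sum_tel_aux L (k + 1) (m - 2 - k)
  rw [show k + 1 + (m - 2 - k) = m - 1 by omega, show m - 1 + 1 = m by omega] at hs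
  rw [hs]
  have g1 := hX (m - 1 - k) k h1 (by omega)
  obtain ⟨e1, e2, e3⟩ := key k h1 (by omega)
  have g2 := hwide (k + 1) (by omega) (by omega)
  rw [Nat.add_sub_cancel] at g2
  have g3 := hLm 1 k le_rfl h1 (by omega)
  have g4 : XX L R k ≤ L (k + 1) + (L (k + 1) - L k) := by
    unfold XX
    rw [div_le_iff₀ (by linarith)]
    have : 0 ≤ (L (k + 1) - L k) * ((R (k + 1) - L k) - 2 * (R k - L (k + 1))) :=
      mul_nonneg (by linarith) (by linarith)
    nlinarith [mul_pos (sub_pos.2 e1) (sub_pos.2 e1), mul_pos (sub_pos.2 e1) (sub_pos.2 e2)]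
  linarith
end

section
/- Let u be a finite sequence in which every symbol occurs at least twice, such that every symbol of u other than the very first symbol of u is left-clamped in u, and every symbol of u other than the very last symbol of u is right-clamped in u. Let S be a finite sequence avoiding ababa, in which every symbol occurs at least twice, that contains u as a (not necessarily contiguous) subsequence. Then the endpoint sequence E(u) is a subsequence of the endpoint sequence E(S) (identifying the letters L_a and R_a of each symbol a of u with the corresponding letters of E(S)). -/
/-- The symbol `a` is left-clamped in the sequence `s`: `s` contains the
subsequence `b a b a`, where `b` is the symbol immediately preceding the first
occurrence of `a` in `s`. -/
def LeftClamped (s : List ℕ) (a : ℕ) : Prop :=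
  ∃ (u v : List ℕ) (b : ℕ), s = u ++ b :: a :: v ∧ a ∉ u ∧ b ≠ a ∧
    [b, a, b, a].Sublist s

/-- The symbol `a` is right-clamped in the sequence `s`: `s` contains the
subsequence `a b a b`, where `b` is the symbol immediately following the last
occurrence of `a` in `s`. -/
def RightClamped (s : List ℕ) (a : ℕ) : Prop :=
  ∃ (u v : List ℕ) (b : ℕ), s = u ++ a :: b :: v ∧ a ∉ v ∧ b ≠ a ∧
    [a, b, a, b].Sublist s

/-- Auxiliary function for the endpoint sequence of a plain sequence; the first
argument collects the symbols already seen. -/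
def EPAux : List ℕ → List ℕ → List (ℕ × Bool)
  | _, [] => []
  | seen, a :: r =>
      if a ∈ seen then
        if a ∈ r then EPAux seen r else (a, true) :: EPAux seen r
      else (a, false) :: EPAux (a :: seen) r

/-- The endpoint sequence `E(s)` of a sequence `s` in which every symbol occurs at
least twice: the first occurrence of each symbol `a` is replaced by the letter
`L_a = (a, false)`, its last occurrence by `R_a = (a, true)`, and all other
occurrences are deleted. -/
def EP (s : List ℕ) : List (ℕ × Bool) := EPAux [] s

def labc (seen s : List ℕ) (i : ℕ) : Option (ℕ × Bool) :=
  match s[i]? with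
  | none => none
  | some a => if a ∈ seen ∨ a ∈ s.take i then
      (if a ∈ s.drop (i+1) then none else some (a, true)) else some (a, false)

theorem EPAux_eq (s : List ℕ) : ∀ seen, EPAux seen s = (List.range s.length).filterMap (labc seen s) := by
  induction s with
  | nil => intro seen; simp [EPAux]
  | cons x s ih =>
    intro seen
    have key : ∀ seen' : List ℕ, (∀ a, a ∈ seen' ↔ (a ∈ seen ∨ a = x)) →
        (labc seen (x :: s)) ∘ Nat.succ = labc seen' s := by
      intro seen' h
      funext i
      simp only [Function.comp, labc, Nat.succ_eq_add_one, List.getElem?_cons_succ,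
        List.take_succ_cons, List.drop_succ_cons, List.mem_cons, h, or_assoc]
    rw [List.length_cons, List.range_succ_eq_map, List.filterMap_cons, List.filterMap_map]
    by_cases hx : x ∈ seen
    · rw [key seen (by intro a; constructor
                       · exact Or.inl
                       · rintro (h | rfl) <;> assumption), ← ih]
      by_cases hr : x ∈ s <;> simp [EPAux, labc, hx, hr]
    · rw [key (x :: seen) (by intro a; simp [or_comm]), ← ih]
      simp [EPAux, labc, hx]

theorem mem_take_iff' (s : List ℕ) (i a : ℕ) : a ∈ s.take i ↔ ∃ j < i, s[j]? = some a := by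
  rw [List.mem_iff_getElem?]
  constructor
  · rintro ⟨j, hj⟩
    rw [List.getElem?_take] at hj
    split_ifs at hj with h
    exact ⟨j, h, hj⟩
  · rintro ⟨j, h, hj⟩
    exact ⟨j, by rw [List.getElem?_take, if_pos h, hj]⟩

theorem mem_drop_iff' (s : List ℕ) (i a : ℕ) : a ∈ s.drop (i+1) ↔ ∃ j, i < j ∧ s[j]? = some a := by
  rw [List.mem_iff_getElem?]
  constructor
  · rintro ⟨j, hj⟩
    rw [List.getElem?_drop] at hj
    exact ⟨_, by omega, hj⟩
  · rintro ⟨j, h, hj⟩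
    exact ⟨j - (i+1), by rw [List.getElem?_drop, ← hj]; congr 1; omega⟩

theorem labc_false (s : List ℕ) (i a : ℕ) : labc [] s i = some (a, false) ↔
    s[i]? = some a ∧ ∀ j < i, s[j]? ≠ some a := by
  unfold labc
  rcases h : s[i]? with _ | b
  · simp
  · have := mem_take_iff' s i b
    simp only [List.not_mem_nil, false_or]
    split_ifs with h1 h2 <;> simp <;> grind

theorem labc_true (s : List ℕ) (i a : ℕ) : labc [] s i = some (a, true) ↔
    s[i]? = some a ∧ (∃ j < i, s[j]? = some a) ∧ ∀ j, i < j → s[j]? ≠ some a := by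
  unfold labc
  rcases h : s[i]? with _ | b
  · simp
  · have := mem_take_iff' s i b
    have := mem_drop_iff' s i b
    simp only [List.not_mem_nil, false_or]
    split_ifs with h1 h2 <;> simp <;> grind

theorem sub_step (S l : List ℕ) (p q a : ℕ) (hq : q ≤ p) (h : S[p]? = some a)
    (hl : l.Sublist (S.drop (p+1))) : (a :: l).Sublist (S.drop q) := by
  refine List.Sublist.trans ?_ (List.drop_sublist_drop_left S hq)
  obtain ⟨hp, rfl⟩ := List.getElem?_eq_some_iff.1 h
  rw [List.drop_eq_getElem_cons hp]
  exact hl.cons_cons _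

theorem sub5 (S : List ℕ) (a b p0 p1 p2 p3 p4 : ℕ) (h01 : p0 < p1) (h12 : p1 < p2) (h23 : p2 < p3)
    (h34 : p3 < p4) (h0 : S[p0]? = some a) (h1 : S[p1]? = some b) (h2 : S[p2]? = some a)
    (h3 : S[p3]? = some b) (h4 : S[p4]? = some a) : [a, b, a, b, a].Sublist S := by
  have := sub_step S [b,a,b,a] p0 0 a (by omega) h0 (sub_step S _ p1 _ b h01 h1
    (sub_step S _ p2 _ a h12 h2 (sub_step S _ p3 _ b h23 h3 (sub_step S _ p4 _ a h34 h4 (by simp)))))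
  simpa using this

theorem sub4 (u : List ℕ) (a b c d : ℕ) (h : [a, b, c, d].Sublist u) :
    ∃ p0 p1 p2 p3 : ℕ, p0 < p1 ∧ p1 < p2 ∧ p2 < p3 ∧ u[p0]? = some a ∧ u[p1]? = some b ∧
      u[p2]? = some c ∧ u[p3]? = some d := by
  obtain ⟨f, hf⟩ := List.sublist_iff_exists_orderEmbedding_getElem?_eq.1 h
  refine ⟨f 0, f 1, f 2, f 3, f.strictMono (by omega), f.strictMono (by omega),
    f.strictMono (by omega), ?_, ?_, ?_, ?_⟩ <;> rw [← hf] <;> rfl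

theorem leftc (u : List ℕ) (c q : ℕ) (hq : u[q]? = some c) (hf : ∀ j < q, u[j]? ≠ some c)
    (h : LeftClamped u c) : ∃ b q', q = q' + 1 ∧ b ≠ c ∧ u[q']? = some b ∧
      ∃ i j, q < i ∧ i < j ∧ u[i]? = some b ∧ u[j]? = some c := by
  obtain ⟨u1, v, b, rfl, h1, hb, h4⟩ := h
  obtain ⟨p0, p1, p2, p3, h01, h12, h23, e0, e1, e2, e3⟩ := sub4 _ _ _ _ _ h4
  have hx : q = u1.length + 1 := by
    rcases lt_trichotomy q (u1.length + 1) with h | h | h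
    · exfalso
      rcases Nat.lt_or_ge q u1.length with h' | h'
      · rw [List.getElem?_append_left h'] at hq
        exact h1 (List.mem_of_getElem? hq)
      · obtain rfl : q = u1.length := by omega
        simp at hq
        exact hb hq
    · exact h
    · exact absurd (by simp) (hf _ h)
  have : q ≤ p1 := by
    by_contra hh
    exact hf p1 (by omega) e1
  exact ⟨b, u1.length, hx, hb, by simp, p2, p3, by omega, h23, e2, e3⟩

theorem rightc (u : List ℕ) (a p : ℕ) (hp : u[p]? = some a) (hf : ∀ j, p < j → u[j]? ≠ some a)
    (h : RightClamped u a) : ∃ b, b ≠ a ∧ u[p+1]? = some b ∧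
      ∃ i j, i < j ∧ j < p ∧ u[i]? = some a ∧ u[j]? = some b := by
  obtain ⟨u1, v, b, rfl, h1, hb, h4⟩ := h
  obtain ⟨p0, p1, p2, p3, h01, h12, h23, e0, e1, e2, e3⟩ := sub4 _ _ _ _ _ h4
  have hx : p = u1.length := by
    rcases lt_trichotomy p (u1.length) with h | h | h
    · exact absurd (by simp) (hf _ h)
    · exact h
    · exfalso
      obtain ⟨k, rfl⟩ := Nat.exists_eq_add_of_lt h
      rw [List.getElem?_append_right (by omega)] at hp
      rw [show u1.length + k + 1 - u1.length = k + 1 by omega, List.getElem?_cons_succ] at hp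
      cases k with
      | zero => simp at hp; exact hb hp
      | succ k => rw [List.getElem?_cons_succ] at hp; exact h1 (List.mem_of_getElem? hp)
  have : p2 ≤ p := by
    by_contra hh
    exact hf p2 (by omega) e2
  exact ⟨b, hb, by simp [hx], p0, p1, h01, by omega, e0, e1⟩

/-- Lemma `lemma_clamped`: let `u` be a sequence in which every symbol occurs at
least twice, all of whose symbols except the very first are left-clamped and all of
whose symbols except the very last are right-clamped.  If `S` is an `ababa`-free
sequence in which every symbol occurs at least twice and which contains `u` as a
subsequence, then `E(u)` is a subsequence of `E(S)`. -/
theorem lemma_clamped (u S : List ℕ)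
    (hu2 : ∀ a ∈ u, 2 ≤ u.count a)
    (huL : ∀ a ∈ u, u.head? ≠ some a → LeftClamped u a)
    (huR : ∀ a ∈ u, u.getLast? ≠ some a → RightClamped u a)
    (hS : ¬ ∃ a b : ℕ, a ≠ b ∧ [a, b, a, b, a].Sublist S)
    (hS2 : ∀ a ∈ S, 2 ≤ S.count a)
    (hsub : u.Sublist S) :
    (EP u).Sublist (EP S) := by
  obtain ⟨f, hf⟩ := List.sublist_iff_exists_orderEmbedding_getElem?_eq.1 hsub
  have fm : ∀ i j, i < j → f i < f j := fun i j h => f.strictMono h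
  have fm' : ∀ i j, i ≤ j → f i ≤ f j := fun i j h => f.monotone h
  have ex : ∀ p x, labc [] u p = some x → ∃ m, labc [] S m = some x ∧
      (x.2 = false → m ≤ f p ∧ ∀ p', p = p' + 1 → f p' < m) ∧
      (x.2 = true → f p ≤ m ∧ (p + 1 < u.length → m < f (p+1))) := by
    rintro p ⟨a, _ | _⟩ hp
    · rw [labc_false] at hp
      have hex : ∃ m, S[m]? = some a := ⟨f p, by rw [← hf, hp.1]⟩
      classical
      refine ⟨Nat.find hex, ?_, ?_, by simp⟩
      · rw [labc_false]
        exact ⟨Nat.find_spec hex, fun j hj => Nat.find_min hex hj⟩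
      · intro _
        refine ⟨Nat.find_min' hex (by rw [← hf, hp.1]), ?_⟩
        rintro p' rfl
        have hc := huL a (List.mem_of_getElem? hp.1)
          (by rw [List.head?_eq_getElem?]; exact hp.2 0 (by omega))
        obtain ⟨b, q', hq', hb, hbq, i, j, hi, hij, ei, ej⟩ := leftc u a _ hp.1 hp.2 hc
        obtain rfl : p' = q' := by omega
        have hm := Nat.find_spec hex
        set m := Nat.find hex
        by_contra hlt
        have hne : m ≠ f p' := by
          intro h
          rw [h, ← hf, hbq] at hm
          exact hb (Option.some.inj hm)
        exact hS ⟨a, b, hb.symm, sub5 S a b m (f p') (f (p'+1)) (f i) (f j) (by omega)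
          (fm _ _ (by omega)) (fm _ _ hi) (fm _ _ hij) hm (by rw [← hf, hbq])
          (by rw [← hf, hp.1]) (by rw [← hf, ei]) (by rw [← hf, ej])⟩
    · rw [labc_true] at hp
      obtain ⟨hp1, ⟨j0, hj0, ej0⟩, hp3⟩ := hp
      have hfp : S[f p]? = some a := by rw [← hf, hp1]
      have hbd : f p ≤ S.length := le_of_lt (List.getElem?_eq_some_iff.1 hfp).1
      classical
      have hm := Nat.findGreatest_spec (P := fun m => S[m]? = some a) hbd hfp
      have hle := Nat.le_findGreatest (P := fun m => S[m]? = some a) hbd hfp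
      have hgr : ∀ k, Nat.findGreatest (fun m => S[m]? = some a) S.length < k → S[k]? ≠ some a := by
        intro k hk h
        exact Nat.findGreatest_is_greatest hk (le_of_lt (List.getElem?_eq_some_iff.1 h).1) h
      set m := Nat.findGreatest (fun m => S[m]? = some a) S.length
      refine ⟨m, ?_, by simp, ?_⟩
      · rw [labc_true]
        exact ⟨hm, ⟨f j0, lt_of_lt_of_le (fm _ _ hj0) hle, by rw [← hf, ej0]⟩, hgr⟩
      · intro _
        refine ⟨hle, fun hlen => ?_⟩
        have hc := huR a (List.mem_of_getElem? hp1)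
          (by rw [List.getLast?_eq_getElem?]; exact hp3 _ (by omega))
        obtain ⟨b, hb, hbq, i, j, hij, hj, ei, ej⟩ := rightc u a _ hp1 hp3 hc
        by_contra hlt
        have hne : m ≠ f (p+1) := by
          intro h
          have hm' : S[m]? = some a := hm
          rw [h, ← hf, hbq] at hm'
          exact hb (Option.some.inj hm')
        exact hS ⟨a, b, hb.symm, sub5 S a b (f i) (f j) (f p) (f (p+1)) m 
          (fm _ _ hij) (fm _ _ hj) (fm _ _ (by omega)) (by omega) (by rw [← hf, ei])
          (by rw [← hf, ej]) hfp (by rw [← hf, hbq]) hm⟩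
  have ex' : ∀ p, ∃ m, ∀ x, labc [] u p = some x → labc [] S m = some x ∧
      (x.2 = false → m ≤ f p ∧ ∀ p', p = p' + 1 → f p' < m) ∧
      (x.2 = true → f p ≤ m ∧ (p + 1 < u.length → m < f (p+1))) := by
    intro p
    rcases h : labc [] u p with _ | x
    · exact ⟨0, by simp⟩
    · obtain ⟨m, hm⟩ := ex p x h
      refine ⟨m, ?_⟩
      intro y hy
      cases hy
      exact hm
  choose g hg using ex'
  have lt_len : ∀ (s : List ℕ) p x, labc [] s p = some x → p < s.length := by
    intro s p x h
    by_contra hh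
    simp [labc, List.getElem?_eq_none (not_lt.1 hh)] at h
  have mono : ∀ p q x y, p < q → labc [] u p = some x → labc [] u q = some y → g p < g q := by
    rintro p q ⟨a, ba⟩ ⟨c, bc⟩ hpq hp hq
    obtain ⟨-, p1, p2⟩ := hg p _ hp
    obtain ⟨-, q1, q2⟩ := hg q _ hq
    have hql := lt_len _ _ _ hq
    obtain ⟨q', rfl⟩ : ∃ q', q = q' + 1 := ⟨q - 1, by omega⟩
    have h1 := fm' p q' (by omega)
    have h2 := fm p (q'+1) hpq
    have h3 := fm' (p+1) (q'+1) (by omega)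
    cases ba <;> cases bc
    · have := p1 rfl; have := (q1 rfl).2 _ rfl; omega
    · have := p1 rfl; have := q2 rfl; omega
    · have hA := (p2 rfl).2 (by omega); have hB := (q1 rfl).2 _ rfl
      rcases Nat.lt_or_ge p q' with h | h
      · have h3 := fm' (p+1) q' (by omega)
        omega
      · exfalso
        obtain rfl : p = q' := by omega
        rw [labc_true] at hp
        rw [labc_false] at hq
        have hc := huL c (List.mem_of_getElem? hq.1)
          (by rw [List.head?_eq_getElem?]; exact hq.2 0 (by omega))
        obtain ⟨b, q', hq', hb, hbq, i, j, hi, hij, ei, ej⟩ := leftc u c _ hq.1 hq.2 hc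
        obtain rfl : p = q' := by omega
        rw [hp.1] at hbq
        cases hbq
        exact hp.2.2 i (by omega) ei
    · have := (p2 rfl).2 (by omega); have := q2 rfl; omega
  unfold EP
  rw [EPAux_eq, EPAux_eq]
  set P := (List.range u.length).filter (fun p => (labc [] u p).isSome) with hP
  have hPm : ∀ p ∈ P, ∃ x, labc [] u p = some x := by
    intro p hp
    rw [hP, List.mem_filter] at hp
    exact Option.isSome_iff_exists.1 hp.2
  have e1 : (List.range u.length).filterMap (labc [] u) = (P.map g).filterMap (labc [] S) := by
    rw [List.filterMap_map, hP, List.filterMap_filter]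
    apply List.filterMap_congr
    intro p _
    rcases h : labc [] u p with _ | x
    · simp
    · simp [(hg p x h).1]
  rw [e1]
  apply List.Sublist.filterMap
  have s1 : (P.map g).Pairwise (· < ·) := by
    rw [List.pairwise_map]
    have : P.Pairwise (· < ·) := List.Pairwise.filter _ List.pairwise_lt_range
    refine this.imp_of_mem ?_
    intro p q hp hq hpq
    obtain ⟨x, hx⟩ := hPm p hp
    obtain ⟨y, hy⟩ := hPm q hq
    exact mono p q x y hpq hx hy
  have s2 : P.map g ⊆ List.range S.length := by
    intro m hm
    obtain ⟨p, hp, rfl⟩ := List.mem_map.1 hm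
    obtain ⟨x, hx⟩ := hPm p hp
    exact List.mem_range.2 (lt_len _ _ _ (hg p x hx).1)
  have nd : (P.map g).Nodup := s1.imp (fun h => ne_of_lt h)
  exact List.sublist_of_subperm_of_pairwise (r := (· < ·)) (List.subperm_of_subset nd s2) s1 List.pairwise_lt_range
end
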